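/- Let E be a finite-dimensional real inner product space, let 𝔍 be a finite set of proper linear subspaces of E, let B_𝔍 = ⋃_{I∈𝔍} I, and let r > 0. Then the connected components of the set B_{𝔍,r} = {x ∈ E : dist(x, I) ≥ r for every I ∈ 𝔍} are exactly the sets C ∩ B_{𝔍,r}, where C ranges over the connected components of E ∖ B_𝔍; in particular each such set C ∩ B_{𝔍,r} is nonempty and connected. (This is Corollary 6.4(4) of the paper.) -/

import Mathlib

/-- Corollary 6.4(4). Let `𝔍` be a finite set of proper subspaces of a
finite-dimensional real inner product space `E`, `B_𝔍 = ⋃_{I∈𝔍} I` and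
`B_{𝔍,r} = {x : dist(x,I) ≥ r ∀ I ∈ 𝔍}` for `r > 0`. The connected components of
`B_{𝔍,r}` are exactly the sets `C ∩ B_{𝔍,r}` with `C` a connected component of
`E ∖ B_𝔍`; in particular each such `C ∩ B_{𝔍,r}` is nonempty and connected. -/
theorem connectedComponents_of_B_r
    {E : Type*} [NormedAddCommGroup E] [InnerProductSpace ℝ E] [FiniteDimensional ℝ E]
    (𝔍 : Finset (Submodule ℝ E)) (hproper : ∀ I ∈ 𝔍, I ≠ ⊤) (r : ℝ) (hr : 0 < r) :
    let B : Set E := ⋃ I ∈ 𝔍, (I : Set E)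
    let Br : Set E := {x : E | ∀ I ∈ 𝔍, r ≤ Metric.infDist x (I : Set E)}
    (∀ x ∈ Bᶜ,
        (connectedComponentIn Bᶜ x ∩ Br).Nonempty ∧
        IsConnected (connectedComponentIn Bᶜ x ∩ Br) ∧
        ∃ y ∈ Br, connectedComponentIn Bᶜ x ∩ Br = connectedComponentIn Br y) ∧
    (∀ y ∈ Br, ∃ x ∈ Bᶜ,
        connectedComponentIn Br y = connectedComponentIn Bᶜ x ∩ Br) := by
  intro B Br
  have hclosed : IsClosed B := by
    apply Set.Finite.isClosed_biUnion 𝔍.finite_toSet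
    intro I _
    exact I.closed_of_finiteDimensional
  have hmemB : ∀ z, z ∈ B ↔ ∃ I ∈ 𝔍, z ∈ I := by
    intro z; simp [B]
  have hsub : Br ⊆ Bᶜ := by
    intro z hz hzB
    obtain ⟨I, hI, hzI⟩ := (hmemB z).1 hzB
    have h1 := hz I hI
    have h2 : Metric.infDist z (I : Set E) = 0 := Metric.infDist_zero_of_mem hzI
    linarith
  have hscale : ∀ (s : ℝ) (z : E), 0 < s → z ∈ Bᶜ → s • z ∈ Bᶜ := by
    intro s z hs hz hzB
    obtain ⟨I, hI, hzI⟩ := (hmemB _).1 hzB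
    exact hz ((hmemB z).2 ⟨I, hI, (I.smul_mem_iff hs.ne').1 hzI⟩)
  let t : E → ℝ := fun z => max 1 (r / Metric.infDist z B)
  let f : E → E := fun z => t z • z
  have ht1 : ∀ z, 1 ≤ t z := fun z => le_max_left _ _
  have hfBr : ∀ z ∈ Bᶜ, f z ∈ Br := by
    intro z hz I hI
    have hIB : (I : Set E) ⊆ B := fun y hy => (hmemB y).2 ⟨I, hI, hy⟩
    have hIne : (I : Set E).Nonempty := ⟨0, I.zero_mem⟩
    have hd : 0 < Metric.infDist z B :=
      (hclosed.notMem_iff_infDist_pos (hIne.mono hIB)).1 hz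
    rw [Metric.le_infDist hIne]
    intro y hy
    have ht0 : 0 < t z := lt_of_lt_of_le one_pos (ht1 z)
    have e : y = t z • ((t z)⁻¹ • y) := by rw [smul_inv_smul₀ ht0.ne']
    have h1 : Metric.infDist z B ≤ dist z ((t z)⁻¹ • y) :=
      Metric.infDist_le_dist_of_mem (hIB (I.smul_mem _ hy))
    have h2 : r ≤ t z * Metric.infDist z B :=
      (div_le_iff₀ hd).1 (le_max_right _ _)
    have h3 : dist (f z) y = t z * dist z ((t z)⁻¹ • y) := by
      conv_lhs => rw [e]
      change dist (t z • z) _ = _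
      rw [dist_smul₀, Real.norm_of_nonneg ht0.le]
    rw [h3]
    exact h2.trans (mul_le_mul_of_nonneg_left h1 ht0.le)
  have hfix : ∀ z ∈ Br, f z = z := by
    intro z hz
    have : t z = 1 := by
      apply max_eq_left
      rcases B.eq_empty_or_nonempty with h | h
      · rw [h, Metric.infDist_empty]; simp
      · have : r ≤ Metric.infDist z B := by
          rw [Metric.le_infDist h]
          intro y hy
          obtain ⟨I, hI, hyI⟩ := (hmemB y).1 hy
          exact (hz I hI).trans (Metric.infDist_le_dist_of_mem hyI)
        exact (div_le_one (hr.trans_le this)).2 this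
    simp [f, this]
  have hcont : ContinuousOn f Bᶜ := by
    refine ContinuousOn.smul (ContinuousOn.sup continuousOn_const ?_) continuousOn_id
    rcases B.eq_empty_or_nonempty with h | h
    · simp only [h, Metric.infDist_empty]; exact continuousOn_const
    · refine continuousOn_const.div (Metric.continuous_infDist_pt B).continuousOn ?_
      intro z hz
      exact ((hclosed.notMem_iff_infDist_pos h).1 hz).ne'
  have hfC : ∀ z ∈ Bᶜ, f z ∈ connectedComponentIn Bᶜ z := by
    intro z hz
    have hp : IsPreconnected ((fun s : ℝ => s • z) '' Set.Icc 1 (t z)) :=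
      isPreconnected_Icc.image _ (by fun_prop)
    refine hp.subset_connectedComponentIn (x := z) ⟨1, ⟨le_rfl, ht1 z⟩, by simp⟩ ?_
      ⟨t z, ⟨ht1 z, le_rfl⟩, rfl⟩
    rintro _ ⟨s, hs, rfl⟩
    exact hscale s z (one_pos.trans_le hs.1) hz
  have himg : ∀ x ∈ Bᶜ, f '' connectedComponentIn Bᶜ x = connectedComponentIn Bᶜ x ∩ Br := by
    intro x hx
    ext w
    constructor
    · rintro ⟨z, hz, rfl⟩
      have hzB : z ∈ Bᶜ := connectedComponentIn_subset _ _ hz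
      refine ⟨?_, hfBr z hzB⟩
      rw [connectedComponentIn_eq hz]
      exact hfC z hzB
    · rintro ⟨hw, hwr⟩
      exact ⟨w, hw, hfix w hwr⟩
  have hconn : ∀ x ∈ Bᶜ, IsConnected (connectedComponentIn Bᶜ x ∩ Br) := by
    intro x hx
    rw [← himg x hx]
    exact (isConnected_connectedComponentIn_iff.2 hx).image _
      (hcont.mono (connectedComponentIn_subset _ _))
  have hkey : ∀ x ∈ Bᶜ, ∀ y ∈ connectedComponentIn Bᶜ x ∩ Br,
      connectedComponentIn Bᶜ x ∩ Br = connectedComponentIn Br y := by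
    intro x hx y hy
    apply Set.Subset.antisymm
    · exact (hconn x hx).isPreconnected.subset_connectedComponentIn hy Set.inter_subset_right
    · refine Set.subset_inter ?_ (connectedComponentIn_subset _ _)
      rw [connectedComponentIn_eq hy.1]
      exact connectedComponentIn_mono _ hsub
  refine ⟨fun x hx => ⟨(hconn x hx).nonempty, hconn x hx, ?_⟩, fun y hy => ⟨y, hsub hy, ?_⟩⟩
  · obtain ⟨y, hy⟩ := (hconn x hx).nonempty
    exact ⟨y, hy.2, hkey x hx y hy⟩
  · exact (hkey y (hsub hy) y ⟨mem_connectedComponentIn (hsub hy), hy⟩).symm
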